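/- Fix T > 0, 1 < α₂ < 2, 0 < ε < 1, and continuous functions z, z̃, w : [0,T] → ℝ with w(t) = J^ε_0 z(t) for all t ∈ [0,T]. Then for every t ∈ [0,T], J^{α₂−ε}_0 |w − z̃|(t) ≤ J^{α₂}_0 |z − z̃|(t) + (T^{α₂−ε} / Γ(α₂−ε+1)) · ‖J^ε_0 z̃ − z̃‖_∞, where ‖g‖_∞ := sup_{τ ∈ [0,T]} |g(τ)|. -/

import Mathlib

/-- Riemann–Liouville fractional integral of order `α` with base point `a`. -/
noncomputable def rlInt (a α : ℝ) (y : ℝ → ℝ) (t : ℝ) : ℝ :=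
  (1 / Real.Gamma α) * ∫ τ in a..t, (t - τ) ^ (α - 1) * y τ

open MeasureTheory Set

/-- The Euler beta integral over `[0, a]` for real exponents. -/
theorem integral_rpow_mul_sub_rpow {u v a : ℝ} (hu : 0 < u) (hv : 0 < v) (ha : 0 < a) :
    ∫ x in (0:ℝ)..a, x ^ (u - 1) * (a - x) ^ (v - 1) =
      a ^ (u + v - 1) * (Real.Gamma u * Real.Gamma v / Real.Gamma (u + v)) := by
  have h := Complex.betaIntegral_scaled (u : ℂ) (v : ℂ) ha
  rw [Complex.betaIntegral_eq_Gamma_mul_div _ _ (by simpa) (by simpa)] at h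
  have h2 : ∫ x in (0:ℝ)..a, (x : ℂ) ^ ((u : ℂ) - 1) * ((a : ℂ) - x) ^ ((v : ℂ) - 1) =
      ∫ x in (0:ℝ)..a, ((x ^ (u - 1) * (a - x) ^ (v - 1) : ℝ) : ℂ) := by
    apply intervalIntegral.integral_congr
    intro x hx
    rw [uIcc_of_le ha.le] at hx
    simp only
    push_cast [Complex.ofReal_cpow hx.1, Complex.ofReal_cpow (sub_nonneg.2 hx.2)]
    rfl
  rw [h2, intervalIntegral.integral_ofReal] at h
  apply Complex.ofReal_injective
  rw [h]
  push_cast [Complex.ofReal_cpow ha.le, ← Complex.Gamma_ofReal]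
  rfl

theorem integral_sub_rpow_mul_sub_rpow {u v s t : ℝ} (hu : 0 < u) (hv : 0 < v) (hst : s < t) :
    ∫ τ in s..t, (t - τ) ^ (u - 1) * (τ - s) ^ (v - 1) =
      (t - s) ^ (u + v - 1) * (Real.Gamma u * Real.Gamma v / Real.Gamma (u + v)) := by
  have h := integral_rpow_mul_sub_rpow hv hu (sub_pos.2 hst)
  have h2 := intervalIntegral.integral_comp_sub_right (a := s) (b := t)
    (fun x => x ^ (v - 1) * ((t - s) - x) ^ (u - 1)) s
  rw [sub_self, h] at h2
  rw [add_comm u v, mul_comm (Real.Gamma u), ← h2]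
  apply intervalIntegral.integral_congr
  intro x _
  simp only [sub_sub_sub_cancel_right]
  ring

theorem intervalIntegrable_sub_rpow_mul_sub_rpow {u v s t : ℝ} (hu : 0 < u) (hv : 0 < v)
    (hst : s < t) :
    IntervalIntegrable (fun τ => (t - τ) ^ (u - 1) * (τ - s) ^ (v - 1)) volume s t := by
  by_contra hcon
  have h := integral_sub_rpow_mul_sub_rpow hu hv hst
  rw [intervalIntegral.integral_undef hcon] at h
  have h1 := Real.Gamma_pos_of_pos hu
  have h2 := Real.Gamma_pos_of_pos hv
  have h3 := Real.Gamma_pos_of_pos (add_pos hu hv)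
  have h4 := Real.rpow_pos_of_pos (sub_pos.2 hst) (u + v - 1)
  exact absurd h (by positivity)

theorem intervalIntegrable_sub_rpow {α : ℝ} (hα : 0 < α) (t : ℝ) :
    IntervalIntegrable (fun τ => (t - τ) ^ (α - 1)) volume 0 t := by
  have h := (intervalIntegral.intervalIntegrable_rpow' (r := α - 1) (a := t) (b := 0)
    (by linarith)).comp_sub_left t
  simpa using h

theorem intervalIntegrable_sub_rpow_mul {α t : ℝ} (hα : 0 < α) (ht : 0 ≤ t) {g : ℝ → ℝ}
    (hg : ContinuousOn g (Icc 0 t)) :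
    IntervalIntegrable (fun τ => (t - τ) ^ (α - 1) * g τ) volume 0 t :=
  (intervalIntegrable_sub_rpow hα t).mul_continuousOn (by rwa [uIcc_of_le ht])

theorem rlInt_const {α : ℝ} (hα : 0 < α) (t c : ℝ) :
    rlInt 0 α (fun _ => c) t = t ^ α / Real.Gamma (α + 1) * c := by
  have h : ∫ τ in (0:ℝ)..t, (t - τ) ^ (α - 1) = t ^ α / α := by
    have h2 := intervalIntegral.integral_comp_sub_left (a := 0) (b := t)
      (fun x : ℝ => x ^ (α - 1)) t
    rw [h2, sub_self, sub_zero, integral_rpow (Or.inl (by linarith))]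
    simp [Real.zero_rpow hα.ne']
  rw [rlInt, intervalIntegral.integral_mul_const, h, Real.Gamma_add_one hα.ne']
  have := (Real.Gamma_pos_of_pos hα).ne'
  field_simp

theorem rlInt_mono {α t : ℝ} (hα : 0 < α) (ht : 0 ≤ t) {f g : ℝ → ℝ}
    (hf : IntervalIntegrable (fun τ => (t - τ) ^ (α - 1) * f τ) volume 0 t)
    (hg : IntervalIntegrable (fun τ => (t - τ) ^ (α - 1) * g τ) volume 0 t)
    (hfg : ∀ τ ∈ Icc 0 t, f τ ≤ g τ) : rlInt 0 α f t ≤ rlInt 0 α g t := by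
  have := Real.Gamma_pos_of_pos hα
  unfold rlInt
  gcongr
  refine intervalIntegral.integral_mono_on ht hf hg fun τ hτ => ?_
  exact mul_le_mul_of_nonneg_left (hfg τ hτ) (Real.rpow_nonneg (sub_nonneg.2 hτ.2) _)

theorem rlInt_add {α t : ℝ} {f g : ℝ → ℝ}
    (hf : IntervalIntegrable (fun τ => (t - τ) ^ (α - 1) * f τ) volume 0 t)
    (hg : IntervalIntegrable (fun τ => (t - τ) ^ (α - 1) * g τ) volume 0 t) :
    rlInt 0 α (fun τ => f τ + g τ) t = rlInt 0 α f t + rlInt 0 α g t := by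
  unfold rlInt
  simp only [mul_add]
  rw [intervalIntegral.integral_add hf hg, mul_add]

theorem rlInt_sub {α t : ℝ} {f g : ℝ → ℝ}
    (hf : IntervalIntegrable (fun τ => (t - τ) ^ (α - 1) * f τ) volume 0 t)
    (hg : IntervalIntegrable (fun τ => (t - τ) ^ (α - 1) * g τ) volume 0 t) :
    rlInt 0 α (fun τ => f τ - g τ) t = rlInt 0 α f t - rlInt 0 α g t := by
  unfold rlInt
  simp only [mul_sub]
  rw [intervalIntegral.integral_sub hf hg, mul_sub]

theorem abs_rlInt_le {α t : ℝ} (hα : 0 < α) (ht : 0 ≤ t) (f : ℝ → ℝ) :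
    |rlInt 0 α f t| ≤ rlInt 0 α (fun τ => |f τ|) t := by
  have := Real.Gamma_pos_of_pos hα
  unfold rlInt
  rw [abs_mul, abs_of_nonneg (by positivity : 0 ≤ 1 / Real.Gamma α)]
  gcongr
  refine (intervalIntegral.abs_integral_le_integral_abs ht).trans_eq ?_
  apply intervalIntegral.integral_congr
  intro τ hτ
  rw [uIcc_of_le ht] at hτ
  simp only [abs_mul, abs_of_nonneg (Real.rpow_nonneg (sub_nonneg.2 hτ.2) (α - 1))]

/-- The triangular kernel whose iterated integrals are the two sides of the semigroup law. -/
noncomputable def rlKernel (β ε t : ℝ) (p : ℝ × ℝ) : ℝ :=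
  {p : ℝ × ℝ | p.2 < p.1}.indicator
    (fun p => (t - p.1) ^ (β - 1) * (p.1 - p.2) ^ (ε - 1)) p

theorem measurable_rlKernel (β ε t : ℝ) : Measurable (rlKernel β ε t) := by
  unfold rlKernel
  refine Measurable.indicator ?_ (measurableSet_lt measurable_snd measurable_fst)
  exact ((measurable_const.sub measurable_fst).pow_const _).mul
    ((measurable_fst.sub measurable_snd).pow_const _)

theorem rlKernel_nonneg {β ε t : ℝ} {p : ℝ × ℝ} (hp : p.1 ≤ t) : 0 ≤ rlKernel β ε t p := by
  refine indicator_apply_nonneg fun h => ?_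
  exact mul_nonneg (Real.rpow_nonneg (sub_nonneg.2 hp) _)
    (Real.rpow_nonneg (sub_nonneg.2 (le_of_lt h)) _)

theorem rlKernel_section_fst (β ε t s : ℝ) : (fun τ => rlKernel β ε t (τ, s)) =
    (Ioi s).indicator fun τ => (t - τ) ^ (β - 1) * (τ - s) ^ (ε - 1) := rfl

theorem rlKernel_section_snd (β ε t τ : ℝ) : (fun s => rlKernel β ε t (τ, s)) =
    (Iio τ).indicator fun s => (t - τ) ^ (β - 1) * (τ - s) ^ (ε - 1) := rfl

theorem integrable_rlKernel_fst {β ε t s : ℝ} (hβ : 0 < β) (hε : 0 < ε) (hs : 0 < s)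
    (hst : s < t) :
    Integrable (fun τ => rlKernel β ε t (τ, s)) (volume.restrict (Ioc 0 t)) := by
  rw [rlKernel_section_fst, integrable_indicator_iff measurableSet_Ioi, IntegrableOn,
    Measure.restrict_restrict measurableSet_Ioi, inter_comm, Ioc_inter_Ioi, sup_of_le_right hs.le]
  exact (intervalIntegrable_iff_integrableOn_Ioc_of_le hst.le).1
    (intervalIntegrable_sub_rpow_mul_sub_rpow hβ hε hst)

theorem integral_rlKernel_fst {β ε t s : ℝ} (hβ : 0 < β) (hε : 0 < ε) (hs : 0 < s)
    (hst : s < t) :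
    ∫ τ in Ioc 0 t, rlKernel β ε t (τ, s) =
      (t - s) ^ (β + ε - 1) * (Real.Gamma β * Real.Gamma ε / Real.Gamma (β + ε)) := by
  rw [rlKernel_section_fst, setIntegral_indicator measurableSet_Ioi, Ioc_inter_Ioi,
    sup_of_le_right hs.le, ← intervalIntegral.integral_of_le hst.le,
    integral_sub_rpow_mul_sub_rpow hβ hε hst]

theorem integral_rlKernel_mul_snd {β ε t τ : ℝ} (hε : 0 < ε) (hτ : τ ∈ Ioc 0 t) (g : ℝ → ℝ) :
    ∫ s in Ioc 0 t, rlKernel β ε t (τ, s) * g s =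
      Real.Gamma ε * ((t - τ) ^ (β - 1) * rlInt 0 ε g τ) := by
  have h : (fun s => rlKernel β ε t (τ, s) * g s) =
      (Iio τ).indicator fun s => (t - τ) ^ (β - 1) * ((τ - s) ^ (ε - 1) * g s) := by
    funext s
    rw [congrFun (rlKernel_section_snd β ε t τ) s]
    by_cases hs : s ∈ Iio τ <;> simp [hs, mul_assoc]
  have hset : Ioc 0 t ∩ Iio τ = Ioo 0 τ := by
    ext s
    exact ⟨fun hs => ⟨hs.1.1, hs.2⟩, fun hs => ⟨⟨hs.1, hs.2.le.trans hτ.2⟩, hs.2⟩⟩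
  rw [h, setIntegral_indicator measurableSet_Iio, hset, integral_const_mul,
    ← integral_Ioc_eq_integral_Ioo, ← intervalIntegral.integral_of_le hτ.1.le, rlInt]
  have := (Real.Gamma_pos_of_pos hε).ne'
  field_simp

theorem integrable_rlKernel_mul {β ε t : ℝ} (hβ : 0 < β) (hε : 0 < ε) (ht : 0 ≤ t) {g : ℝ → ℝ}
    (hg : ContinuousOn g (Icc 0 t)) :
    Integrable (fun p : ℝ × ℝ => rlKernel β ε t p * g p.2)
      ((volume.restrict (Ioc 0 t)).prod (volume.restrict (Ioc 0 t))) := by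
  have hgm : AEStronglyMeasurable g (volume.restrict (Ioc 0 t)) :=
    (hg.mono Ioc_subset_Icc_self).aestronglyMeasurable measurableSet_Ioc
  have hae : ∀ᵐ s ∂(volume.restrict (Ioc 0 t)), s ∈ Ioo 0 t := by
    rw [← Measure.restrict_congr_set (Ioo_ae_eq_Ioc (μ := volume) (a := 0) (b := t))]
    exact ae_restrict_mem measurableSet_Ioo
  have hm : AEStronglyMeasurable (fun p : ℝ × ℝ => rlKernel β ε t p * g p.2)
      ((volume.restrict (Ioc 0 t)).prod (volume.restrict (Ioc 0 t))) :=
    (measurable_rlKernel β ε t).aestronglyMeasurable.mul hgm.comp_snd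
  rw [integrable_prod_iff' hm]
  constructor
  · filter_upwards [hae] with s hs
    exact (integrable_rlKernel_fst hβ hε hs.1 hs.2).mul_const _
  · have hint : Integrable (fun s => Real.Gamma β * Real.Gamma ε / Real.Gamma (β + ε) *
        ((t - s) ^ (β + ε - 1) * |g s|)) (volume.restrict (Ioc 0 t)) :=
      ((intervalIntegrable_iff_integrableOn_Ioc_of_le ht).1
        (intervalIntegrable_sub_rpow_mul (add_pos hβ hε) ht hg.abs)).const_mul _
    refine hint.congr ?_
    filter_upwards [hae] with s hs
    have h : ∫ τ in Ioc 0 t, ‖rlKernel β ε t (τ, s) * g s‖ =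
        ∫ τ in Ioc 0 t, rlKernel β ε t (τ, s) * |g s| := by
      refine setIntegral_congr_fun measurableSet_Ioc fun τ hτ => ?_
      simp only [norm_mul, Real.norm_eq_abs, abs_of_nonneg (rlKernel_nonneg (p := (τ, s)) hτ.2)]
    rw [h, integral_mul_const, integral_rlKernel_fst hβ hε hs.1 hs.2]
    ring

theorem intervalIntegrable_sub_rpow_mul_rlInt {β ε t : ℝ} (hβ : 0 < β) (hε : 0 < ε) (ht : 0 ≤ t)
    {g : ℝ → ℝ} (hg : ContinuousOn g (Icc 0 t)) :
    IntervalIntegrable (fun τ => (t - τ) ^ (β - 1) * rlInt 0 ε g τ) volume 0 t := by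
  rw [intervalIntegrable_iff_integrableOn_Ioc_of_le ht]
  refine ((integrable_rlKernel_mul hβ hε ht hg).integral_prod_left.const_mul
    (Real.Gamma ε)⁻¹).congr ?_
  filter_upwards [ae_restrict_mem measurableSet_Ioc] with τ hτ
  rw [integral_rlKernel_mul_snd hε hτ, inv_mul_cancel_left₀ (Real.Gamma_pos_of_pos hε).ne']

/-- The semigroup law for Riemann–Liouville fractional integrals. -/
theorem rlInt_rlInt {β ε t : ℝ} (hβ : 0 < β) (hε : 0 < ε) (ht : 0 ≤ t)
    {g : ℝ → ℝ} (hg : ContinuousOn g (Icc 0 t)) :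
    rlInt 0 β (rlInt 0 ε g) t = rlInt 0 (β + ε) g t := by
  have hswap := integral_integral_swap (f := fun τ s => rlKernel β ε t (τ, s) * g s)
    (integrable_rlKernel_mul hβ hε ht hg)
  have hae : ∀ᵐ s ∂(volume.restrict (Ioc 0 t)), s ∈ Ioo 0 t := by
    rw [← Measure.restrict_congr_set (Ioo_ae_eq_Ioc (μ := volume) (a := 0) (b := t))]
    exact ae_restrict_mem measurableSet_Ioo
  have hleft : ∫ τ in Ioc 0 t, ∫ s in Ioc 0 t, rlKernel β ε t (τ, s) * g s =
      Real.Gamma ε * ∫ τ in Ioc 0 t, (t - τ) ^ (β - 1) * rlInt 0 ε g τ := by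
    rw [← integral_const_mul]
    exact setIntegral_congr_fun measurableSet_Ioc fun τ hτ => integral_rlKernel_mul_snd hε hτ g
  have hright : ∫ s in Ioc 0 t, ∫ τ in Ioc 0 t, rlKernel β ε t (τ, s) * g s =
      Real.Gamma β * Real.Gamma ε / Real.Gamma (β + ε) *
        ∫ s in Ioc 0 t, (t - s) ^ (β + ε - 1) * g s := by
    rw [← integral_const_mul]
    refine integral_congr_ae ?_
    filter_upwards [hae] with s hs
    rw [integral_mul_const, integral_rlKernel_fst hβ hε hs.1 hs.2]
    ring
  rw [hleft, hright] at hswap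
  have h1 := (Real.Gamma_pos_of_pos hβ).ne'
  have h2 := (Real.Gamma_pos_of_pos hε).ne'
  have h3 := (Real.Gamma_pos_of_pos (add_pos hβ hε)).ne'
  rw [rlInt, rlInt, intervalIntegral.integral_of_le ht, intervalIntegral.integral_of_le ht]
  refine mul_left_cancel₀ (mul_ne_zero h1 h2) ?_
  calc _ = Real.Gamma ε * ∫ τ in Ioc 0 t, (t - τ) ^ (β - 1) * rlInt 0 ε g τ := by field_simp
    _ = _ := by rw [hswap]; field_simp

theorem bddAbove_abs_rlInt_sub {T ε : ℝ} (hε : 0 < ε) {g : ℝ → ℝ}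
    (hg : ContinuousOn g (Icc 0 T)) :
    BddAbove (range fun τ : Icc (0:ℝ) T => |rlInt 0 ε g τ - g τ|) := by
  obtain ⟨M, hM⟩ := isCompact_Icc.exists_bound_of_continuousOn hg
  simp only [Real.norm_eq_abs] at hM
  refine ⟨T ^ ε / Real.Gamma (ε + 1) * M + M, ?_⟩
  rintro _ ⟨⟨τ, hτ⟩, rfl⟩
  have hsub : Icc 0 τ ⊆ Icc 0 T := Icc_subset_Icc_right hτ.2
  have hM0 : 0 ≤ M := (abs_nonneg _).trans (hM τ hτ)
  have hΓ := Real.Gamma_pos_of_pos (add_pos hε one_pos)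
  have h : |rlInt 0 ε g τ| ≤ T ^ ε / Real.Gamma (ε + 1) * M := calc
    _ ≤ rlInt 0 ε (fun s => |g s|) τ := abs_rlInt_le hε hτ.1 g
    _ ≤ rlInt 0 ε (fun _ => M) τ :=
      rlInt_mono hε hτ.1 (intervalIntegrable_sub_rpow_mul hε hτ.1 (hg.mono hsub).abs)
        (intervalIntegrable_sub_rpow_mul hε hτ.1 continuousOn_const)
        fun s hs => hM s (hsub hs)
    _ = τ ^ ε / Real.Gamma (ε + 1) * M := rlInt_const hε τ M
    _ ≤ _ := by
      have := Real.rpow_le_rpow hτ.1 hτ.2 hε.le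
      gcongr
  exact (abs_sub _ _).trans (add_le_add h (hM τ hτ))

theorem stmt7 (T α₂ ε : ℝ) (z zt w : ℝ → ℝ)
    (hT : 0 < T) (hα₂ : 1 < α₂) (hα₂' : α₂ < 2) (hε : 0 < ε) (hε1 : ε < 1)
    (hz : ContinuousOn z (Set.Icc 0 T)) (hzt : ContinuousOn zt (Set.Icc 0 T))
    (hw : ContinuousOn w (Set.Icc 0 T))
    (hweq : ∀ t ∈ Set.Icc (0:ℝ) T, w t = rlInt 0 ε z t) :
    ∀ t ∈ Set.Icc (0:ℝ) T,
      rlInt 0 (α₂ - ε) (fun τ => |w τ - zt τ|) t ≤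
        rlInt 0 α₂ (fun τ => |z τ - zt τ|) t +
          T ^ (α₂ - ε) / Real.Gamma (α₂ - ε + 1) *
            (⨆ τ : Set.Icc (0:ℝ) T, |rlInt 0 ε zt τ - zt τ|) := by
  intro t ht
  set C := ⨆ τ : Set.Icc (0:ℝ) T, |rlInt 0 ε zt τ - zt τ| with hC
  have hβ : 0 < α₂ - ε := by linarith
  have hsub : ∀ τ ∈ Icc 0 T, Icc 0 τ ⊆ Icc 0 T := fun τ hτ => Icc_subset_Icc_right hτ.2
  have hbdd := bddAbove_abs_rlInt_sub hε hzt
  have hC0 : 0 ≤ C := Real.iSup_nonneg fun _ => abs_nonneg _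
  have hpt : ∀ τ ∈ Icc 0 t, |w τ - zt τ| ≤ rlInt 0 ε (fun s => |z s - zt s|) τ + C := by
    intro τ hτ
    have hτT := hsub t ht hτ
    have h1 : w τ - zt τ = rlInt 0 ε (fun s => z s - zt s) τ + (rlInt 0 ε zt τ - zt τ) := by
      rw [hweq τ hτT, rlInt_sub (intervalIntegrable_sub_rpow_mul hε hτ.1 (hz.mono (hsub τ hτT)))
        (intervalIntegrable_sub_rpow_mul hε hτ.1 (hzt.mono (hsub τ hτT)))]
      ring
    rw [h1]
    exact (abs_add_le _ _).trans
      (add_le_add (abs_rlInt_le hε hτ.1 _) (le_ciSup hbdd ⟨τ, hτT⟩))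
  have hd : ContinuousOn (fun s => |z s - zt s|) (Icc 0 t) := ((hz.sub hzt).mono (hsub t ht)).abs
  have hJ := intervalIntegrable_sub_rpow_mul_rlInt hβ hε ht.1 hd
  have hK := intervalIntegrable_sub_rpow_mul (g := fun _ => C) hβ ht.1 continuousOn_const
  have hΓ := Real.Gamma_pos_of_pos (add_pos hβ one_pos)
  calc rlInt 0 (α₂ - ε) (fun τ => |w τ - zt τ|) t
      ≤ rlInt 0 (α₂ - ε) (fun τ => rlInt 0 ε (fun s => |z s - zt s|) τ + C) t :=
        rlInt_mono hβ ht.1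
          (intervalIntegrable_sub_rpow_mul hβ ht.1 ((hw.sub hzt).mono (hsub t ht)).abs)
          (by simpa only [mul_add] using hJ.add hK) hpt
    _ = rlInt 0 α₂ (fun τ => |z τ - zt τ|) t + t ^ (α₂ - ε) / Real.Gamma (α₂ - ε + 1) * C := by
        rw [rlInt_add hJ hK, rlInt_const hβ, rlInt_rlInt hβ hε ht.1 hd, sub_add_cancel]
    _ ≤ _ := by
        have := Real.rpow_le_rpow ht.1 ht.2 hβ.le
        gcongr
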